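/- arXiv:2001.07275 — 2 statements merged into one kernel-verified Lean document; each statement's English description precedes it below -/
import Mathlib

section
/- If G₁, ..., G_k are finite groups of pairwise coprime orders and H_i is a subgroup of G_i for each i, then ψ_{H₁×⋯×H_k}(G₁×⋯×G_k) = ∏_{i=1}^k ψ_{H_i}(G_i). -/
/-- The order of `x` relative to the subgroup `H`: the smallest positive
integer `k` such that `x ^ k ∈ H`. -/
noncomputable def relOrder {G : Type*} [Group G] (H : Subgroup G) (x : G) : ℕ :=
  sInf {k : ℕ | 0 < k ∧ x ^ k ∈ H}

/-- `ψ_H(G)`: the sum over all elements of `G` of their orders relative to `H`. -/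
noncomputable def psiRel (G : Type*) [Group G] (H : Subgroup G) : ℕ :=
  ∑ᶠ x : G, relOrder H x

/-- `ψ(G)`: the sum of the orders of the elements of `G`. -/
noncomputable def psiSum (G : Type*) [Group G] : ℕ :=
  ∑ᶠ x : G, orderOf x

section RelOrder

variable {G : Type*} [Group G] [Finite G] (H : Subgroup G) (x : G)

theorem relOrder_spec : 0 < relOrder H x ∧ x ^ relOrder H x ∈ H :=
  Nat.sInf_mem (s := {k : ℕ | 0 < k ∧ x ^ k ∈ H})
    ⟨orderOf x, orderOf_pos x, by simp [pow_orderOf_eq_one]⟩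

theorem pow_mem_iff_relOrder_dvd {n : ℕ} : x ^ n ∈ H ↔ relOrder H x ∣ n := by
  obtain ⟨hpos, hmem⟩ := relOrder_spec H x
  constructor
  · intro hn
    rw [Nat.dvd_iff_mod_eq_zero]
    by_contra hr
    have hmod : x ^ (n % relOrder H x) ∈ H := by
      rw [← Nat.mod_add_div n (relOrder H x), pow_add, pow_mul] at hn
      exact (H.mul_mem_cancel_right (H.pow_mem hmem _)).1 hn
    exact (Nat.mod_lt n hpos).not_ge (Nat.sInf_le ⟨Nat.pos_of_ne_zero hr, hmod⟩)
  · rintro ⟨m, rfl⟩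
    rw [pow_mul]
    exact H.pow_mem hmem m

theorem relOrder_dvd_card : relOrder H x ∣ Nat.card G :=
  (pow_mem_iff_relOrder_dvd H x).1 (by simp [pow_card_eq_one'])

end RelOrder

theorem relOrder_pi {ι : Type*} [Fintype ι] {G : ι → Type*} [∀ i, Group (G i)]
    [∀ i, Finite (G i)]
    (hcop : ∀ i j, i ≠ j → Nat.Coprime (Nat.card (G i)) (Nat.card (G j)))
    (H : ∀ i, Subgroup (G i)) (x : ∀ i, G i) :
    relOrder (Subgroup.pi Set.univ H) x = ∏ i, relOrder (H i) (x i) := by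
  rw [← Finset.lcm_eq_prod fun i _ j _ hij =>
    ((hcop i j hij).coprime_dvd_left (relOrder_dvd_card _ _)).coprime_dvd_right
      (relOrder_dvd_card _ _)]
  refine Nat.dvd_left_injective (funext fun n => propext ?_)
  simp [← pow_mem_iff_relOrder_dvd, Subgroup.mem_pi, Finset.lcm_dvd_iff]

/-- If `G₁, ..., G_k` are finite groups of pairwise coprime orders and
`H i ≤ G i` for each `i`, then `ψ_{H₁ × ⋯ × H_k}(G₁ × ⋯ × G_k) = ∏ i, ψ_{H i}(G i)`. -/
theorem psiRel_pi {k : ℕ} (G : Fin k → Type*) [∀ i, Group (G i)] [∀ i, Finite (G i)]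
    (hcop : ∀ i j, i ≠ j → Nat.Coprime (Nat.card (G i)) (Nat.card (G j)))
    (H : ∀ i, Subgroup (G i)) :
    psiRel (∀ i, G i) (Subgroup.pi Set.univ H) = ∏ i, psiRel (G i) (H i) := by
  have (i : Fin k) : Fintype (G i) := Fintype.ofFinite (G i)
  simp only [psiRel, finsum_eq_sum_of_fintype, relOrder_pi hcop, Fintype.prod_sum]
end

section
/- Let n be a positive integer, m a divisor of n, C_n the cyclic group of order n, and H_m its unique subgroup of order m. Then ψ_{H_m}(C_n) = m · ψ(C_{n/m}), where ψ(C_{n/m}) is the sum of element orders of the cyclic group of order n/m. -/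
theorem relOrder_eq_orderOf_mk {G : Type*} [Group G] (H : Subgroup G) [H.Normal] (x : G) :
    relOrder H x = orderOf (x : G ⧸ H) := by
  have key (k : ℕ) : x ^ k ∈ H ↔ (x : G ⧸ H) ^ k = 1 := by
    rw [← QuotientGroup.mk_pow, QuotientGroup.eq_one_iff]
  unfold relOrder
  simp only [key]
  by_cases hfin : IsOfFinOrder (x : G ⧸ H)
  · refine IsLeast.csInf_eq ⟨⟨hfin.orderOf_pos, pow_orderOf_eq_one _⟩, ?_⟩
    rintro k ⟨hk, hxk⟩
    exact orderOf_le_of_pow_eq_one hk hxk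
  · rw [orderOf_eq_zero hfin, Nat.sInf_eq_zero]
    refine Or.inr (Set.eq_empty_of_forall_notMem ?_)
    rintro k ⟨hk, hxk⟩
    exact hfin (isOfFinOrder_iff_pow_eq_one.mpr ⟨k, hk, hxk⟩)

theorem psiRel_eq_card_mul_psiSum_quotient {G : Type*} [Group G] [Finite G] (H : Subgroup G)
    [H.Normal] : psiRel G H = Nat.card H * psiSum (G ⧸ H) := by
  classical
  have := Fintype.ofFinite G
  have := Fintype.ofFinite (G ⧸ H)
  unfold psiRel psiSum
  rw [finsum_eq_sum_of_fintype, finsum_eq_sum_of_fintype, Finset.mul_sum,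
    ← Finset.sum_fiberwise Finset.univ (QuotientGroup.mk' H)]
  refine Finset.sum_congr rfl fun q _ => ?_
  have hcard : (Finset.univ.filter fun x => QuotientGroup.mk' H x = q).card = Nat.card H := by
    have h := Nat.card_congr
      ((QuotientGroup.mk' H).fiberEquivKerOfSurjective (QuotientGroup.mk'_surjective H) q)
    rw [QuotientGroup.ker_mk'] at h
    rw [← h, ← Fintype.card_subtype, ← Nat.card_eq_fintype_card]
    rfl
  rw [← hcard, ← smul_eq_mul]
  refine Finset.sum_eq_card_nsmul fun x hx => ?_
  rw [relOrder_eq_orderOf_mk, ← (Finset.mem_filter.mp hx).2]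
  rfl

theorem psiSum_congr {G K : Type*} [Group G] [Group K] (e : G ≃* K) : psiSum G = psiSum K :=
  finsum_eq_of_bijective e e.bijective fun x => (e.orderOf_eq x).symm

/-- If `m ∣ n` with `n > 0` and `H_m` is the (unique) subgroup of
order `m` of the cyclic group `C_n`, then `ψ_{H_m}(C_n) = m * ψ(C_{n / m})`. -/
theorem psiRel_cyclic_eq_mul_psiSum {n m : ℕ} (hn : 0 < n) (hmn : m ∣ n)
    (Hm : Subgroup (Multiplicative (ZMod n))) (hcard : Nat.card Hm = m) :
    psiRel (Multiplicative (ZMod n)) Hm = m * psiSum (Multiplicative (ZMod (n / m))) := by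
  subst hcard
  have : NeZero n := ⟨hn.ne'⟩
  have hindex : Nat.card (Multiplicative (ZMod n) ⧸ Hm) = n / Nat.card Hm := by
    have h := Hm.card_eq_card_quotient_mul_card_subgroup
    rw [Nat.card_congr Multiplicative.toAdd, Nat.card_zmod] at h
    exact (Nat.div_eq_of_eq_mul_left Nat.card_pos h).symm
  have hcyc : IsCyclic (Multiplicative (ZMod n) ⧸ Hm) :=
    isCyclic_of_surjective (QuotientGroup.mk' Hm) (QuotientGroup.mk'_surjective Hm)
  rw [psiRel_eq_card_mul_psiSum_quotient, ← hindex]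
  exact congrArg _ (psiSum_congr (zmodCyclicMulEquiv hcyc).symm)
end
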